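/- Let p be a prime, n ≥ 1, α > 0, N ∈ ℤ, Ω = B_N ⊆ ℚ_p^n. Let f ∈ L²(Ω), g ∈ L¹(Ω^c), and suppose there exists a bounded, measurable, locally constant function ψ : K^n → ℝ such that (N_α ψ)(y) = g(y) for all y ∈ Ω^c. Then the Neumann problem D^{α,n}u = f on Ω, N_α u = g on Ω^c admits a weak solution u ∈ H^α_g(Ω) if and only if ∫_Ω f(x) dx = − ∫_{Ω^c} g(y) dy. -/

import Mathlib

noncomputable section

open MeasureTheory Metric ENNReal

instance (p : ℕ) [Fact p.Prime] : MeasurableSpace ℚ_[p] := borel _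
instance (p : ℕ) [Fact p.Prime] : BorelSpace ℚ_[p] := ⟨rfl⟩

/-- The closed unit ball `ℤ_p ⊆ ℚ_p` as a positive compact set. -/
def padicUnitBall (p : ℕ) [Fact p.Prime] : TopologicalSpace.PositiveCompacts ℚ_[p] where
  carrier := Metric.closedBall 0 1
  isCompact' := isCompact_closedBall 0 1
  interior_nonempty' := by
    rw [IsOpen.interior_eq (IsUltrametricDist.isOpen_closedBall 0 one_ne_zero)]
    exact ⟨0, Metric.mem_closedBall_self zero_le_one⟩

/-- Additive Haar measure on `ℚ_p`, normalized so that `ℤ_p` has measure `1`. -/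
def padicHaar (p : ℕ) [Fact p.Prime] : Measure ℚ_[p] :=
  Measure.addHaarMeasure (padicUnitBall p)

/-- The product Haar measure on `K^n = ℚ_p^n`, normalized so that `ℤ_p^n` has measure `1`. -/
def padicHaarN (p : ℕ) [Fact p.Prime] (n : ℕ) : Measure (Fin n → ℚ_[p]) :=
  Measure.pi fun _ => padicHaar p

/-- The ball `B_N = {x ∈ K^n : ‖x‖ ≤ p^N}`, where `‖x‖ = max |x_j|_p` is the sup norm. -/
def Bball (p : ℕ) [Fact p.Prime] (n : ℕ) (N : ℤ) : Set (Fin n → ℚ_[p]) :=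
  {x | ‖x‖ ≤ (p : ℝ) ^ N}

/-- The constant `c_{n,α} = (p^α − 1)/(1 − p^{−α−n})`. -/
def cna (p n : ℕ) (α : ℝ) : ℝ := ((p : ℝ) ^ α - 1) / (1 - (p : ℝ) ^ (-α - (n : ℝ)))

/-- The Vladimirov–Taibleson operator `(D^{α,n}u)(x) = c_{n,α} ∫ (u(x)−u(y))/‖x−y‖^{n+α} dy`. -/
def Dop (p : ℕ) [Fact p.Prime] (n : ℕ) (α : ℝ) (u : (Fin n → ℚ_[p]) → ℝ)
    (x : Fin n → ℚ_[p]) : ℝ :=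
  cna p n α * ∫ y, (u x - u y) / ‖x - y‖ ^ ((n : ℝ) + α) ∂padicHaarN p n

/-- The nonlocal normal derivative `(N_α u)(x) = c_{n,α} ∫_Ω (u(x)−u(y))/‖x−y‖^{n+α} dy`. -/
def Nop (p : ℕ) [Fact p.Prime] (n : ℕ) (α : ℝ) (N : ℤ) (u : (Fin n → ℚ_[p]) → ℝ)
    (x : Fin n → ℚ_[p]) : ℝ :=
  cna p n α * ∫ y in Bball p n N, (u x - u y) / ‖x - y‖ ^ ((n : ℝ) + α) ∂padicHaarN p n

/-- The squared norm of the space `H^α_ρ(Ω)`, `Ω = B_N` (value in `[0,∞]`). -/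
def normSqH (p : ℕ) [Fact p.Prime] (n : ℕ) (α : ℝ) (N : ℤ)
    (ρ u : (Fin n → ℚ_[p]) → ℝ) : ℝ≥0∞ :=
  (∫⁻ x in Bball p n N, ENNReal.ofReal ((u x) ^ 2) ∂padicHaarN p n)
  + (∫⁻ x in (Bball p n N)ᶜ, ENNReal.ofReal (|ρ x| * (u x) ^ 2) ∂padicHaarN p n)
  + ∫⁻ z in ((Bball p n N)ᶜ ×ˢ (Bball p n N)ᶜ)ᶜ,
      ENNReal.ofReal ((u z.1 - u z.2) ^ 2 / ‖z.1 - z.2‖ ^ ((n : ℝ) + α))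
      ∂((padicHaarN p n).prod (padicHaarN p n))

/-- Membership in `H^α_ρ(Ω)`: measurable with finite `H^α_ρ(Ω)`-norm. -/
def MemH (p : ℕ) [Fact p.Prime] (n : ℕ) (α : ℝ) (N : ℤ)
    (ρ u : (Fin n → ℚ_[p]) → ℝ) : Prop :=
  Measurable u ∧ normSqH p n α N ρ u < ⊤

/-- `u` is a weak solution of the Neumann problem `D^{α,n}u = f` on `Ω`,
`N_α u = g` on `Ω^c`, where `Ω = B_N`. -/
def IsWeakSolution (p : ℕ) [Fact p.Prime] (n : ℕ) (α : ℝ) (N : ℤ)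
    (f g u : (Fin n → ℚ_[p]) → ℝ) : Prop :=
  MemH p n α N g u ∧
  ∀ v : (Fin n → ℚ_[p]) → ℝ, MemH p n α N g v →
    cna p n α / 2 *
      ∫ z in ((Bball p n N)ᶜ ×ˢ (Bball p n N)ᶜ)ᶜ,
        (u z.1 - u z.2) * (v z.1 - v z.2) / ‖z.1 - z.2‖ ^ ((n : ℝ) + α)
        ∂((padicHaarN p n).prod (padicHaarN p n))
    = (∫ x in Bball p n N, f x * v x ∂padicHaarN p n)
      + ∫ y in (Bball p n N)ᶜ, g y * v y ∂padicHaarN p n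


instance (p : ℕ) [Fact p.Prime] : (padicHaar p).IsAddHaarMeasure := by
  unfold padicHaar; infer_instance
instance (p : ℕ) [Fact p.Prime] (n : ℕ) : (padicHaarN p n).IsAddHaarMeasure := by
  unfold padicHaarN; infer_instance
instance (p : ℕ) [Fact p.Prime] (n : ℕ) : SigmaFinite (padicHaarN p n) := by
  unfold padicHaarN; infer_instance

lemma Bball_eq (p : ℕ) [Fact p.Prime] (n : ℕ) (N : ℤ) :
    Bball p n N = Metric.closedBall 0 ((p : ℝ) ^ N) := by
  ext x; simp [Bball]

lemma haar_ball_succ (p : ℕ) [hp : Fact p.Prime] (j : ℤ) :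
    padicHaar p (Metric.closedBall 0 ((p : ℝ) ^ (j + 1))) ≤
      p * padicHaar p (Metric.closedBall 0 ((p : ℝ) ^ j)) := by
  have hp0 : (p : ℝ) ≠ 0 := by exact_mod_cast hp.1.ne_zero
  have hpp : (0 : ℝ) < p := by exact_mod_cast hp.1.pos
  have hpq : (p : ℚ_[p]) ≠ 0 := by exact_mod_cast hp.1.ne_zero
  have hsub : Metric.closedBall (0 : ℚ_[p]) ((p : ℝ) ^ (j + 1)) ⊆
      ⋃ m ∈ Finset.range p,
        Metric.closedBall ((m : ℚ_[p]) * (p : ℚ_[p]) ^ (-(j+1))) ((p : ℝ) ^ j) := by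
    intro x hx
    have hx : ‖x‖ ≤ (p : ℝ) ^ (j + 1) := by simpa using hx
    have hy : ‖(p : ℚ_[p]) ^ (j + 1) * x‖ ≤ 1 := by
      rw [norm_mul, Padic.norm_p_zpow]
      calc (p : ℝ) ^ (-(j+1)) * ‖x‖ ≤ (p : ℝ) ^ (-(j+1)) * (p : ℝ) ^ (j + 1) := by gcongr
        _ = 1 := by rw [← zpow_add₀ hp0]; simp
    let t : ℤ_[p] := ⟨(p : ℚ_[p]) ^ (j + 1) * x, hy⟩
    obtain ⟨m, hm, hm'⟩ := PadicInt.exists_mem_range t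
    rw [PadicInt.maximalIdeal_eq_span_p, ← pow_one (p : ℤ_[p]), ← PadicInt.norm_le_pow_iff_mem_span_pow] at hm'
    simp only [Set.mem_iUnion, Finset.mem_range]
    refine ⟨m, hm, ?_⟩
    rw [Metric.mem_closedBall, dist_eq_norm]
    have e : x - (m : ℚ_[p]) * (p : ℚ_[p]) ^ (-(j+1)) =
        ((p : ℚ_[p]) ^ (j + 1) * x - m) * (p : ℚ_[p]) ^ (-(j+1)) := by
      rw [sub_mul, mul_right_comm, ← zpow_add₀ hpq]; simp
    have h1 : ‖(p : ℚ_[p]) ^ (j + 1) * x - m‖ ≤ (p : ℝ) ^ (-1 : ℤ) := by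
      have e2 : ((t - (m : ℤ_[p]) : ℤ_[p]) : ℚ_[p]) =
          (p : ℚ_[p]) ^ (j + 1) * x - m := by push_cast; rfl
      rw [← e2, ← PadicInt.norm_def]
      simpa using hm'
    rw [e, norm_mul, Padic.norm_p_zpow]
    calc _ ≤ (p : ℝ) ^ (-1 : ℤ) * (p : ℝ) ^ (- -(j+1)) := by gcongr
      _ = _ := by rw [← zpow_add₀ hp0]; congr 1; ring
  refine (measure_mono hsub).trans ((measure_biUnion_finset_le _ _).trans ?_)
  have : ∀ m ∈ Finset.range p, padicHaar p
      (Metric.closedBall ((m : ℚ_[p]) * (p : ℚ_[p]) ^ (-(j+1))) ((p : ℝ) ^ j)) =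
      padicHaar p (Metric.closedBall 0 ((p : ℝ) ^ j)) := by
    intro m _
    rw [← vadd_closedBall_zero]
    exact measure_vadd _ _ _
  rw [Finset.sum_congr rfl this]
  simp

lemma haar_ball_add (p : ℕ) [hp : Fact p.Prime] (N : ℤ) (j : ℕ) :
    padicHaar p (Metric.closedBall 0 ((p : ℝ) ^ (N + j))) ≤
      p ^ j * padicHaar p (Metric.closedBall 0 ((p : ℝ) ^ N)) := by
  induction j with
  | zero => simp
  | succ j ih =>
    have := haar_ball_succ p (N + j)
    push_cast
    rw [← add_assoc]
    refine this.trans ?_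
    rw [pow_succ', mul_assoc]
    gcongr

lemma haarN_ball_add (p : ℕ) [hp : Fact p.Prime] (n : ℕ) (N : ℤ) (j : ℕ) :
    padicHaarN p n (Bball p n (N + j)) ≤
      ENNReal.ofReal ((p : ℝ) ^ (n * j)) * padicHaarN p n (Bball p n N) := by
  have hpp : (0 : ℝ) < p := by exact_mod_cast hp.1.pos
  rw [Bball_eq, Bball_eq, padicHaarN, Measure.pi_closedBall _ _ (by positivity),
    Measure.pi_closedBall _ _ (by positivity)]
  simp only [Pi.zero_apply, Finset.prod_const, Finset.card_univ, Fintype.card_fin]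
  rw [ENNReal.ofReal_pow hpp.le, ENNReal.ofReal_natCast, mul_comm n j, pow_mul, ← mul_pow]
  gcongr
  exact haar_ball_add p N j

lemma Bball_meas (p : ℕ) [Fact p.Prime] (n : ℕ) (N : ℤ) : MeasurableSet (Bball p n N) := by
  rw [Bball_eq]; exact measurableSet_closedBall

lemma Bball_lt_top (p : ℕ) [Fact p.Prime] (n : ℕ) (N : ℤ) :
    padicHaarN p n (Bball p n N) < ⊤ := by
  rw [Bball_eq]; exact (isCompact_closedBall _ _).measure_lt_top

lemma Bball_pos (p : ℕ) [hp : Fact p.Prime] (n : ℕ) (N : ℤ) :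
    0 < padicHaarN p n (Bball p n N) := by
  have hpp : (0 : ℝ) < p := by exact_mod_cast hp.1.pos
  rw [Bball_eq]; exact Metric.measure_closedBall_pos _ _ (by positivity)

lemma Bball_compl_pos (p : ℕ) [hp : Fact p.Prime] (n : ℕ) (hn : 1 ≤ n) (N : ℤ) :
    0 < padicHaarN p n (Bball p n N)ᶜ := by
  have hp1 : (1 : ℝ) < p := by exact_mod_cast hp.1.one_lt
  apply IsOpen.measure_pos
  · rw [Bball_eq]; exact Metric.isClosed_closedBall.isOpen_compl
  · refine ⟨fun _ => (p : ℚ_[p]) ^ (-(N+1)), ?_⟩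
    have : Nonempty (Fin n) := ⟨⟨0, hn⟩⟩
    simp only [Bball, Set.mem_compl_iff, Set.mem_ofPred_eq, not_le, pi_norm_const, Padic.norm_p_zpow]
    apply zpow_lt_zpow_right₀ hp1; omega

lemma w_integrable (p : ℕ) [hp : Fact p.Prime] (n : ℕ) (α : ℝ) (hα : 0 < α) (N : ℤ) :
    IntegrableOn (fun y : Fin n → ℚ_[p] => (‖y‖ ^ ((n : ℝ) + α))⁻¹) (Bball p n N)ᶜ
      (padicHaarN p n) := by
  have hp1 : (1 : ℝ) < p := by exact_mod_cast hp.1.one_lt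
  have hp0 : (0 : ℝ) < p := by linarith
  have hm : Measurable (fun y : Fin n → ℚ_[p] => (‖y‖ ^ ((n : ℝ) + α))⁻¹) := by fun_prop
  refine ⟨hm.aestronglyMeasurable, ?_⟩
  rw [hasFiniteIntegral_iff_ofReal (Filter.Eventually.of_forall fun y => by positivity)]
  have hcov : (Bball p n N)ᶜ ⊆ ⋃ j : ℕ, Bball p n (N + (j + 1 : ℕ)) \ Bball p n (N + j) := by
    intro y hy
    have hex : ∃ j : ℕ, y ∈ Bball p n (N + j) := by
      obtain ⟨j, hj⟩ := pow_unbounded_of_one_lt (‖y‖ / (p:ℝ) ^ N) hp1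
      refine ⟨j, ?_⟩
      rw [div_lt_iff₀ (by positivity)] at hj
      simp only [Bball, Set.mem_ofPred_eq]
      rw [zpow_add₀ hp0.ne', mul_comm]; exact_mod_cast hj.le
    classical
    have h1 := Nat.find_spec hex
    rcases hj : Nat.find hex with _ | j
    · rw [hj] at h1; simp at h1; exact absurd h1 hy
    · rw [hj] at h1
      exact Set.mem_iUnion.2 ⟨j, h1, Nat.find_min hex (by omega)⟩
  refine (lintegral_mono_set hcov).trans_lt ((lintegral_iUnion_le _ _).trans_lt ?_)
  set M := padicHaarN p n (Bball p n N)
  have hb : ∀ j : ℕ, (∫⁻ y in Bball p n (N + (j + 1 : ℕ)) \ Bball p n (N + j),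
      ENNReal.ofReal ((‖y‖ ^ ((n : ℝ) + α))⁻¹) ∂padicHaarN p n) ≤
      ENNReal.ofReal ((p : ℝ) ^ n * ((p:ℝ) ^ (N * ((n:ℝ) + α)))⁻¹ * ((p:ℝ) ^ (-α)) ^ j) * M := by
    intro j
    have : ∀ y ∈ Bball p n (N + (j + 1 : ℕ)) \ Bball p n (N + j),
        ENNReal.ofReal ((‖y‖ ^ ((n : ℝ) + α))⁻¹) ≤
        ENNReal.ofReal (((p:ℝ) ^ (((N:ℝ) + j) * ((n:ℝ) + α)))⁻¹) := by
      intro y hy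
      have hy2 : (p : ℝ) ^ (N + (j:ℤ)) < ‖y‖ := by simpa [Bball] using hy.2
      apply ENNReal.ofReal_le_ofReal
      apply inv_anti₀ (by positivity)
      rw [Real.rpow_mul hp0.le]
      apply Real.rpow_le_rpow (by positivity) _ (by positivity)
      rw [show (N : ℝ) + (j : ℝ) = ((N + (j : ℤ) : ℤ) : ℝ) by push_cast; rfl, Real.rpow_intCast]
      exact hy2.le
    refine (setLIntegral_mono measurable_const this).trans ?_
    rw [setLIntegral_const]
    refine (mul_le_mul_right ((measure_mono Set.sdiff_subset).trans (haarN_ball_add p n N (j+1))) _).trans ?_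
    rw [← mul_assoc, ← ENNReal.ofReal_mul (by positivity)]
    refine le_of_eq ?_
    congr 2
    rw [← Real.rpow_neg hp0.le, ← Real.rpow_neg hp0.le, ← Real.rpow_natCast _ (n * (j+1)),
      ← Real.rpow_natCast _ n, ← Real.rpow_natCast _ j, ← Real.rpow_mul hp0.le, 
      ← Real.rpow_add hp0, ← Real.rpow_add hp0, ← Real.rpow_add hp0]
    congr 1
    push_cast; ring
  refine (ENNReal.tsum_le_tsum hb).trans_lt ?_
  rw [ENNReal.tsum_mul_right]
  refine ENNReal.mul_lt_top ?_ (Bball_lt_top p n N)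
  have hs : Summable (fun j : ℕ => (p : ℝ) ^ n * ((p:ℝ) ^ (N * ((n:ℝ) + α)))⁻¹ * ((p:ℝ) ^ (-α)) ^ j) :=
    (summable_geometric_of_lt_one (by positivity)
      (Real.rpow_lt_one_of_one_lt_of_neg hp1 (by linarith))).mul_left _
  rw [← ENNReal.ofReal_tsum_of_nonneg (fun j => by positivity) hs]
  exact ENNReal.ofReal_lt_top

def graphSub {X : Type*} [MeasurableSpace X] (ν : Measure X) [IsFiniteMeasure ν]
    (r : X × X → ℝ) : Submodule ℝ (WithLp 2 (Lp ℝ 2 ν × Lp ℝ 2 (ν.prod ν))) where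
  carrier := {s | (s.snd : X × X → ℝ) =ᵐ[ν.prod ν]
    fun z => r z * ((s.fst : X → ℝ) z.1 - (s.fst : X → ℝ) z.2)}
  zero_mem' := by
    have h0 := Lp.coeFn_zero ℝ 2 ν
    have h1 := (Measure.quasiMeasurePreserving_fst (μ := ν) (ν := ν)).ae h0
    have h2 := (Measure.quasiMeasurePreserving_snd (μ := ν) (ν := ν)).ae h0
    have h3 := Lp.coeFn_zero ℝ 2 (ν.prod ν)
    filter_upwards [h1, h2, h3] with z h1 h2 h3
    simp only [WithLp.zero_fst, WithLp.zero_snd]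
    rw [h1, h2, h3]; simp
  add_mem' := by
    intro a b ha hb
    have h0 := Lp.coeFn_add a.fst b.fst
    have h1 := (Measure.quasiMeasurePreserving_fst (μ := ν) (ν := ν)).ae h0
    have h2 := (Measure.quasiMeasurePreserving_snd (μ := ν) (ν := ν)).ae h0
    have h3 := Lp.coeFn_add a.snd b.snd
    change _ =ᵐ[_] _
    change _ =ᵐ[_] _ at ha
    change _ =ᵐ[_] _ at hb
    filter_upwards [h1, h2, h3, ha, hb] with z h1 h2 h3 ha hb
    simp only [WithLp.add_fst, WithLp.add_snd]
    rw [h1, h2, h3]; simp only [Pi.add_apply]; rw [ha, hb]; ring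
  smul_mem' := by
    intro c a ha
    have h0 := Lp.coeFn_smul c a.fst
    have h1 := (Measure.quasiMeasurePreserving_fst (μ := ν) (ν := ν)).ae h0
    have h2 := (Measure.quasiMeasurePreserving_snd (μ := ν) (ν := ν)).ae h0
    have h3 := Lp.coeFn_smul c a.snd
    change _ =ᵐ[_] _
    change _ =ᵐ[_] _ at ha
    filter_upwards [h1, h2, h3, ha] with z h1 h2 h3 ha
    simp only [WithLp.smul_fst, WithLp.smul_snd]
    rw [h1, h2, h3]; simp only [Pi.smul_apply, smul_eq_mul]; rw [ha]; ring

lemma graphSub_closed {X : Type*} [MeasurableSpace X] (ν : Measure X) [IsFiniteMeasure ν]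
    (r : X × X → ℝ) :
    IsClosed (graphSub ν r : Set (WithLp 2 (Lp ℝ 2 ν × Lp ℝ 2 (ν.prod ν)))) := by
  apply IsSeqClosed.isClosed
  intro s a hs ha
  have hf : Filter.Tendsto (fun k => (s k).fst) Filter.atTop (nhds a.fst) :=
    ((WithLp.prod_continuous_ofLp 2 _ _).fst.tendsto a).comp ha
  have hg : Filter.Tendsto (fun k => (s k).snd) Filter.atTop (nhds a.snd) :=
    ((WithLp.prod_continuous_ofLp 2 _ _).snd.tendsto a).comp ha
  obtain ⟨φ, hφ, h0⟩ := (tendstoInMeasure_of_tendsto_Lp hf).exists_seq_tendsto_ae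
  obtain ⟨χ, hχ, h3⟩ := (tendstoInMeasure_of_tendsto_Lp
    (hg.comp hφ.tendsto_atTop)).exists_seq_tendsto_ae
  have h1 := (Measure.quasiMeasurePreserving_fst (μ := ν) (ν := ν)).ae h0
  have h2 := (Measure.quasiMeasurePreserving_snd (μ := ν) (ν := ν)).ae h0
  have h4 := ae_all_iff.2 hs
  change _ =ᵐ[_] _
  filter_upwards [h1, h2, h3, h4] with z h1 h2 h3 h4
  refine tendsto_nhds_unique h3 ?_
  have := (((h1.sub h2).const_mul (r z)).comp hχ.tendsto_atTop)
  refine this.congr fun k => ?_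
  exact (h4 (φ (χ k))).symm

lemma exists_graph_solution {X : Type*} [MeasurableSpace X] (ν : Measure X) [IsFiniteMeasure ν]
    (r : X × X → ℝ) (F : X → ℝ) (hF : MemLp F 2 ν) :
    ∃ u : X → ℝ, Measurable u ∧ MemLp u 2 ν ∧
      MemLp (fun z : X × X => r z * (u z.1 - u z.2)) 2 (ν.prod ν) ∧
      ∀ v : X → ℝ, MemLp v 2 ν →
        MemLp (fun z : X × X => r z * (v z.1 - v z.2)) 2 (ν.prod ν) →
        (∫ z, (r z * (u z.1 - u z.2)) * (r z * (v z.1 - v z.2)) ∂(ν.prod ν))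
          + ∫ x, u x * v x ∂ν = ∫ x, F x * v x ∂ν := by
  have hc : CompleteSpace (graphSub ν r) := (graphSub_closed ν r).completeSpace_coe
  let b : WithLp 2 (Lp ℝ 2 ν × Lp ℝ 2 (ν.prod ν)) := WithLp.toLp 2 (hF.toLp F, 0)
  set a := (graphSub ν r).starProjection b with ha
  have hmem : a ∈ graphSub ν r := Submodule.starProjection_apply_mem _ _
  change _ =ᵐ[_] _ at hmem
  have hu0 : (a.fst : X → ℝ) =ᵐ[ν] (Lp.aestronglyMeasurable a.fst).mk _ :=
    (Lp.aestronglyMeasurable a.fst).ae_eq_mk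
  set u := (Lp.aestronglyMeasurable a.fst).mk _ with hu
  have h1 := (Measure.quasiMeasurePreserving_fst (μ := ν) (ν := ν)).ae hu0
  have h2 := (Measure.quasiMeasurePreserving_snd (μ := ν) (ν := ν)).ae hu0
  have hU : (a.snd : X × X → ℝ) =ᵐ[ν.prod ν] fun z => r z * (u z.1 - u z.2) := by
    filter_upwards [hmem, h1, h2] with z h h1 h2
    rw [h, h1, h2]
  refine ⟨u, (Lp.aestronglyMeasurable a.fst).stronglyMeasurable_mk.measurable,
    (Lp.memLp a.fst).ae_eq hu0, (Lp.memLp a.snd).ae_eq hU, ?_⟩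
  intro v hv hV
  let w : WithLp 2 (Lp ℝ 2 ν × Lp ℝ 2 (ν.prod ν)) := WithLp.toLp 2 (hv.toLp v, hV.toLp _)
  have hw : w ∈ graphSub ν r := by
    change _ =ᵐ[_] _
    have h0 := hv.coeFn_toLp
    have h1 := (Measure.quasiMeasurePreserving_fst (μ := ν) (ν := ν)).ae h0
    have h2 := (Measure.quasiMeasurePreserving_snd (μ := ν) (ν := ν)).ae h0
    filter_upwards [h1, h2, hV.coeFn_toLp] with z h1 h2 h3
    change hV.toLp _ z = r z * (hv.toLp v z.1 - hv.toLp v z.2)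
    rw [h1, h2, h3]
  have e1 : (∫ x, inner ℝ ((WithLp.fst b : Lp ℝ 2 ν) x) ((WithLp.fst w : Lp ℝ 2 ν) x) ∂ν)
      = ∫ x, F x * v x ∂ν := by
    apply integral_congr_ae
    filter_upwards [hF.coeFn_toLp, hv.coeFn_toLp] with x hx hy
    change inner ℝ (hF.toLp F x) (hv.toLp v x) = _
    rw [hx, hy]; simp [mul_comm]
  have e2 : (∫ x, inner ℝ ((WithLp.fst a : Lp ℝ 2 ν) x) ((WithLp.fst w : Lp ℝ 2 ν) x) ∂ν)
      = ∫ x, u x * v x ∂ν := by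
    apply integral_congr_ae
    filter_upwards [hu0, hv.coeFn_toLp] with x hx hy
    change inner ℝ (a.fst x) (hv.toLp v x) = _
    rw [hx, hy]; simp [mul_comm]
  have e3 : (∫ x, inner ℝ ((WithLp.snd a : Lp ℝ 2 (ν.prod ν)) x)
        ((WithLp.snd w : Lp ℝ 2 (ν.prod ν)) x) ∂(ν.prod ν))
      = ∫ z, (r z * (u z.1 - u z.2)) * (r z * (v z.1 - v z.2)) ∂(ν.prod ν) := by
    apply integral_congr_ae
    filter_upwards [hU, hV.coeFn_toLp] with x hx hy
    change inner ℝ (a.snd x) (hV.toLp _ x) = _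
    rw [hx, hy]; simp [mul_comm]
  have e4 : inner ℝ (WithLp.snd b : Lp ℝ 2 (ν.prod ν)) (WithLp.snd w : Lp ℝ 2 (ν.prod ν)) = 0 := by
    change inner ℝ (0 : Lp ℝ 2 (ν.prod ν)) _ = 0
    exact inner_zero_left _
  have k1 : inner ℝ b w = ∫ x, F x * v x ∂ν := by
    rw [WithLp.prod_inner_apply, ← e1, ← L2.inner_def]
    exact (congrArg _ e4).trans (add_zero _)
  have k2 : inner ℝ a w = (∫ x, u x * v x ∂ν) +
      ∫ z, (r z * (u z.1 - u z.2)) * (r z * (v z.1 - v z.2)) ∂(ν.prod ν) := by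
    rw [WithLp.prod_inner_apply, ← e2, ← e3]
    rfl
  have key := Submodule.starProjection_inner_eq_zero (K := graphSub ν r) b w hw
  rw [inner_sub_left, ← ha, k1, k2] at key
  linarith

lemma S_eq {X : Type*} (A : Set X) : (Aᶜ ×ˢ Aᶜ)ᶜ = (A ×ˢ A ∪ A ×ˢ Aᶜ) ∪ Aᶜ ×ˢ A := by
  ext z; simp only [Set.mem_compl_iff, Set.mem_prod, Set.mem_union]; tauto

lemma S_disj {X : Type*} (A : Set X) : Disjoint (A ×ˢ A) (A ×ˢ Aᶜ) := by
  rw [Set.disjoint_left]; rintro z ⟨_, h⟩ ⟨_, h'⟩; exact h' h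

lemma S_disj' {X : Type*} (A : Set X) : Disjoint (A ×ˢ A ∪ A ×ˢ Aᶜ) (Aᶜ ×ˢ A) := by
  rw [Set.disjoint_left]; rintro z (⟨h, _⟩ | ⟨h, _⟩) ⟨h', _⟩ <;> exact h' h

lemma swap_pre {X : Type*} (A : Set X) : Prod.swap ⁻¹' (Aᶜ ×ˢ A) = A ×ˢ Aᶜ := by
  ext z; simp

lemma lintegral_S {X : Type*} [MeasurableSpace X] (μ : Measure X) [SigmaFinite μ] {A : Set X}
    (hA : MeasurableSet A) (Φ : X × X → ℝ≥0∞) (hs : ∀ z, Φ z.swap = Φ z) :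
    ∫⁻ z in (Aᶜ ×ˢ Aᶜ)ᶜ, Φ z ∂(μ.prod μ) = (∫⁻ z in A ×ˢ A, Φ z ∂(μ.prod μ)) +
      2 * ∫⁻ z in A ×ˢ Aᶜ, Φ z ∂(μ.prod μ) := by
  rw [S_eq, lintegral_union (hA.compl.prod hA) (S_disj' A),
    lintegral_union (hA.prod hA.compl) (S_disj A)]
  have : ∫⁻ z in Aᶜ ×ˢ A, Φ z ∂(μ.prod μ) = ∫⁻ z in A ×ˢ Aᶜ, Φ z ∂(μ.prod μ) := by
    rw [← (Measure.measurePreserving_swap (μ := μ) (ν := μ)).setLIntegral_comp_preimage_emb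
      MeasurableEquiv.prodComm.measurableEmbedding, swap_pre]
    simp only [hs]
  rw [this]; ring

lemma integral_S {X : Type*} [MeasurableSpace X] (μ : Measure X) [SigmaFinite μ] {A : Set X}
    (hA : MeasurableSet A) (Φ : X × X → ℝ) (hs : ∀ z, Φ z.swap = Φ z)
    (h1 : IntegrableOn Φ (A ×ˢ A) (μ.prod μ)) (h2 : IntegrableOn Φ (A ×ˢ Aᶜ) (μ.prod μ)) :
    ∫ z in (Aᶜ ×ˢ Aᶜ)ᶜ, Φ z ∂(μ.prod μ) = (∫ z in A ×ˢ A, Φ z ∂(μ.prod μ)) +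
      2 * ∫ z in A ×ˢ Aᶜ, Φ z ∂(μ.prod μ) := by
  have hmp := Measure.measurePreserving_swap (μ := μ) (ν := μ)
  have hme : MeasurableEmbedding (Prod.swap : X × X → X × X) :=
    MeasurableEquiv.prodComm.measurableEmbedding
  have h3 : IntegrableOn Φ (Aᶜ ×ˢ A) (μ.prod μ) := by
    rw [← hmp.integrableOn_comp_preimage hme, swap_pre]
    exact h2.congr_fun (fun z _ => (hs z).symm) (hA.prod hA.compl)
  rw [S_eq, setIntegral_union (S_disj' A) (hA.compl.prod hA) (h1.union h2) h3,
    setIntegral_union (S_disj A) (hA.prod hA.compl) h1 h2]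
  have : ∫ z in Aᶜ ×ˢ A, Φ z ∂(μ.prod μ) = ∫ z in A ×ˢ Aᶜ, Φ z ∂(μ.prod μ) := by
    rw [← hmp.setIntegral_preimage_emb hme, swap_pre]
    simp only [hs]
  rw [this]; ring

lemma int_iff {X : Type*} [MeasurableSpace X] {μ : Measure X} {f : X → ℝ} (hf : Measurable f)
    (h0 : ∀ x, 0 ≤ f x) : Integrable f μ ↔ ∫⁻ x, ENNReal.ofReal (f x) ∂μ < ⊤ := by
  rw [← hasFiniteIntegral_iff_ofReal (Filter.Eventually.of_forall h0)]
  exact ⟨fun h => h.2, fun h => ⟨hf.aestronglyMeasurable, h⟩⟩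

lemma norm_sub_out {p : ℕ} [Fact p.Prime] {n : ℕ} {N : ℤ} {x y : Fin n → ℚ_[p]}
    (hx : x ∈ Bball p n N) (hy : y ∈ (Bball p n N)ᶜ) : ‖x - y‖ = ‖y‖ := by
  have hx' : ‖x‖ ≤ (p : ℝ) ^ N := hx
  have hy' : (p : ℝ) ^ N < ‖y‖ := not_le.1 hy
  have h : ‖x‖ < ‖-y‖ := by rw [norm_neg]; linarith
  rw [sub_eq_add_neg, IsUltrametricDist.norm_add_eq_max_of_norm_ne_norm h.ne, max_eq_right h.le,
    norm_neg]

lemma memH_iff (p : ℕ) [Fact p.Prime] (n : ℕ) (α : ℝ) (N : ℤ)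
    (ρ v : (Fin n → ℚ_[p]) → ℝ) (hρ : Measurable ρ) (hv : Measurable v) :
    MemH p n α N ρ v ↔
      IntegrableOn (fun x => v x ^ 2) (Bball p n N) (padicHaarN p n) ∧
      IntegrableOn (fun x => |ρ x| * v x ^ 2) (Bball p n N)ᶜ (padicHaarN p n) ∧
      IntegrableOn (fun z : (Fin n → ℚ_[p]) × (Fin n → ℚ_[p]) =>
        (v z.1 - v z.2) ^ 2 / ‖z.1 - z.2‖ ^ ((n : ℝ) + α)) (Bball p n N ×ˢ Bball p n N)
        ((padicHaarN p n).prod (padicHaarN p n)) ∧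
      IntegrableOn (fun z : (Fin n → ℚ_[p]) × (Fin n → ℚ_[p]) =>
        (v z.1 - v z.2) ^ 2 / ‖z.1 - z.2‖ ^ ((n : ℝ) + α)) (Bball p n N ×ˢ (Bball p n N)ᶜ)
        ((padicHaarN p n).prod (padicHaarN p n)) := by
  have hsw : ∀ z : (Fin n → ℚ_[p]) × (Fin n → ℚ_[p]),
      ENNReal.ofReal ((v z.swap.1 - v z.swap.2) ^ 2 / ‖z.swap.1 - z.swap.2‖ ^ ((n : ℝ) + α)) =
      ENNReal.ofReal ((v z.1 - v z.2) ^ 2 / ‖z.1 - z.2‖ ^ ((n : ℝ) + α)) := by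
    intro z
    simp only [Prod.fst_swap, Prod.snd_swap]
    rw [norm_sub_rev, show v z.2 - v z.1 = -(v z.1 - v z.2) by ring, neg_sq]
  have hm1 : Measurable (fun x => v x ^ 2) := by fun_prop
  have hm2 : Measurable (fun x => |ρ x| * v x ^ 2) := by fun_prop
  have hm3 : Measurable (fun z : (Fin n → ℚ_[p]) × (Fin n → ℚ_[p]) =>
        (v z.1 - v z.2) ^ 2 / ‖z.1 - z.2‖ ^ ((n : ℝ) + α)) := by fun_prop
  unfold MemH normSqH
  rw [lintegral_S _ (Bball_meas p n N) _ hsw]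
  simp only [IntegrableOn]
  rw [int_iff hm1 (fun x => by positivity), int_iff hm2 (fun x => by positivity),
    int_iff hm3 (fun x => by positivity), int_iff hm3 (fun x => by positivity)]
  simp only [ENNReal.add_lt_top, hv, true_and]
  have h2 : ∀ a : ℝ≥0∞, 2 * a < ⊤ ↔ a < ⊤ := by
    intro a
    rw [two_mul, ENNReal.add_lt_top, and_self]
  rw [h2]; tauto

lemma cna_pos (p : ℕ) [hp : Fact p.Prime] (n : ℕ) (α : ℝ) (hα : 0 < α) : 0 < cna p n α := by
  have hp1 : (1 : ℝ) < p := by exact_mod_cast hp.1.one_lt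
  apply div_pos
  · have := Real.one_lt_rpow hp1 hα; linarith
  · have : (p : ℝ) ^ (-α - (n : ℝ)) < 1 :=
      Real.rpow_lt_one_of_one_lt_of_neg hp1 (by have : (0:ℝ) ≤ n := by positivity
                                                linarith)
    linarith

lemma W_pos (p : ℕ) [hp : Fact p.Prime] (n : ℕ) (hn : 1 ≤ n) (α : ℝ) (hα : 0 < α) (N : ℤ) :
    0 < ∫ y in (Bball p n N)ᶜ, (‖y‖ ^ ((n : ℝ) + α))⁻¹ ∂padicHaarN p n := by
  have hp0 : (0 : ℝ) < p := by exact_mod_cast hp.1.pos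
  rw [setIntegral_pos_iff_support_of_nonneg_ae (Filter.Eventually.of_forall fun y => by
    simp only [Pi.zero_apply]; positivity) (w_integrable p n α hα N)]
  refine (Bball_compl_pos p n hn N).trans_le (measure_mono fun y hy => ⟨?_, hy⟩)
  have hy' : (p : ℝ) ^ N < ‖y‖ := not_le.1 hy
  have : 0 < ‖y‖ := lt_trans (by positivity) hy'
  simp only [Function.mem_support]
  positivity

/-- Cross term: integrability and value. -/
lemma cross_term {X : Type*} [MeasurableSpace X] (ν κ : Measure X) [IsFiniteMeasure ν] [SFinite κ]
    (u v U V w : X → ℝ) (huv : Integrable (fun x => u x * v x) ν)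
    (hu : Integrable u ν) (hv : Integrable v ν) (hw : Integrable w κ)
    (hVw : Integrable (fun y => V y * w y) κ) (hUw : Integrable (fun y => U y * w y) κ)
    (hUVw : Integrable (fun y => U y * V y * w y) κ) :
    Integrable (fun z : X × X => (u z.1 - U z.2) * (v z.1 - V z.2) * w z.2) (ν.prod κ) ∧
    ∫ z : X × X, (u z.1 - U z.2) * (v z.1 - V z.2) * w z.2 ∂(ν.prod κ) =
      (∫ x, u x * v x ∂ν) * (∫ y, w y ∂κ) - (∫ x, u x ∂ν) * (∫ y, V y * w y ∂κ)
      - (∫ x, v x ∂ν) * (∫ y, U y * w y ∂κ) + ν.real Set.univ * ∫ y, U y * V y * w y ∂κ := by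
  have h1 := huv.mul_prod hw
  have h2 := hu.mul_prod hVw
  have h3 := hv.mul_prod hUw
  have h4 := (integrable_const (1 : ℝ) (μ := ν)).mul_prod hUVw
  have e : (fun z : X × X => (u z.1 - U z.2) * (v z.1 - V z.2) * w z.2) =
      fun z => (u z.1 * v z.1) * w z.2 - u z.1 * (V z.2 * w z.2) - v z.1 * (U z.2 * w z.2)
        + 1 * (U z.2 * V z.2 * w z.2) := by
    ext z; ring
  have h12 : Integrable (fun z : X × X => (u z.1 * v z.1) * w z.2 - u z.1 * (V z.2 * w z.2))
    (ν.prod κ) := h1.sub h2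
  have h123 : Integrable (fun z : X × X => (u z.1 * v z.1) * w z.2 - u z.1 * (V z.2 * w z.2)
    - v z.1 * (U z.2 * w z.2)) (ν.prod κ) := h12.sub h3
  refine ⟨?_, ?_⟩
  · rw [e]; exact h123.add h4
  · rw [e, integral_add h123 h4, integral_sub h12 h3, integral_sub h1 h2,
      integral_prod_mul (fun x => u x * v x) w, integral_prod_mul u (fun y => V y * w y),
      integral_prod_mul v (fun y => U y * w y),
      integral_prod_mul (fun _ => (1 : ℝ)) (fun y => U y * V y * w y)]
    simp

lemma wv_integrable (p : ℕ) [hp : Fact p.Prime] (n : ℕ) (α : ℝ) (hα : 0 < α) (N : ℤ)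
    (v : (Fin n → ℚ_[p]) → ℝ) (hv : Measurable v)
    (h1 : IntegrableOn (fun x => v x ^ 2) (Bball p n N) (padicHaarN p n))
    (h2 : IntegrableOn (fun z : (Fin n → ℚ_[p]) × (Fin n → ℚ_[p]) =>
        (v z.1 - v z.2) ^ 2 / ‖z.1 - z.2‖ ^ ((n : ℝ) + α)) (Bball p n N ×ˢ (Bball p n N)ᶜ)
        ((padicHaarN p n).prod (padicHaarN p n))) :
    IntegrableOn (fun y => v y ^ 2 * (‖y‖ ^ ((n : ℝ) + α))⁻¹) (Bball p n N)ᶜ (padicHaarN p n) := by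
  have hΩ := Bball_meas p n N
  have hne : (padicHaarN p n).restrict (Bball p n N) ≠ 0 := by
    rw [Ne, Measure.restrict_eq_zero]; exact (Bball_pos p n N).ne'
  refine Integrable.of_comp_snd (μ := (padicHaarN p n).restrict (Bball p n N)) ?_ hne
  have hw := w_integrable p n α hα N
  have h3 := h1.mul_prod hw
  rw [IntegrableOn, ← Measure.prod_restrict] at h2
  refine Integrable.mono' ((h2.const_mul 2).add (h3.const_mul 2)) ?_ ?_
  · apply Measurable.aestronglyMeasurable; fun_prop
  · rw [Measure.prod_restrict]
    refine ae_restrict_of_forall_mem (hΩ.prod hΩ.compl) ?_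
    rintro ⟨x, y⟩ ⟨hx, hy⟩
    simp only [Pi.add_apply]
    rw [norm_sub_out hx hy, Real.norm_of_nonneg (by positivity), div_eq_mul_inv]
    have hw0 : 0 ≤ (‖y‖ ^ ((n : ℝ) + α))⁻¹ := by positivity
    nlinarith [mul_nonneg hw0 (sq_nonneg (2 * v x - v y))]

lemma Nop_out (p : ℕ) [hp : Fact p.Prime] (n : ℕ) (α : ℝ) (N : ℤ)
    (ψ : (Fin n → ℚ_[p]) → ℝ) (hψ : IntegrableOn ψ (Bball p n N) (padicHaarN p n))
    (y : Fin n → ℚ_[p]) (hy : y ∈ (Bball p n N)ᶜ) :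
    Nop p n α N ψ y = cna p n α * (((padicHaarN p n).real (Bball p n N) * ψ y
      - ∫ x in Bball p n N, ψ x ∂padicHaarN p n) * (‖y‖ ^ ((n : ℝ) + α))⁻¹) := by
  unfold Nop
  congr 1
  have : ∫ x in Bball p n N, (ψ y - ψ x) / ‖y - x‖ ^ ((n : ℝ) + α) ∂padicHaarN p n =
      ∫ x in Bball p n N, (ψ y - ψ x) * (‖y‖ ^ ((n : ℝ) + α))⁻¹ ∂padicHaarN p n := by
    apply setIntegral_congr_fun (Bball_meas p n N)
    intro x hx
    simp only
    rw [norm_sub_rev, norm_sub_out hx hy, div_eq_mul_inv]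
  have hfin : IntegrableOn (fun _ => ψ y) (Bball p n N) (padicHaarN p n) :=
    integrableOn_const (Bball_lt_top p n N).ne
  rw [this, integral_mul_const, integral_sub hfin hψ, setIntegral_const, smul_eq_mul]

lemma suff_direction (p : ℕ) [Fact p.Prime] (n : ℕ) (hn : 1 ≤ n)
    (α : ℝ) (hα : 0 < α) (N : ℤ)
    (f g : (Fin n → ℚ_[p]) → ℝ)
    (hfmeas : Measurable f)
    (hfL2 : (∫⁻ x in Bball p n N, ENNReal.ofReal ((f x) ^ 2) ∂padicHaarN p n) < ⊤)
    (hgmeas : Measurable g)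
    (hgL1 : IntegrableOn g (Bball p n N)ᶜ (padicHaarN p n))
    (ψ : (Fin n → ℚ_[p]) → ℝ) (hψmeas : Measurable ψ)
    (hψbdd : ∃ C : ℝ, ∀ x, |ψ x| ≤ C)
    (hψg : ∀ y ∈ (Bball p n N)ᶜ, Nop p n α N ψ y = g y)
    (hcomp : (∫ x in Bball p n N, f x ∂padicHaarN p n)
        = - ∫ y in (Bball p n N)ᶜ, g y ∂padicHaarN p n) :
    ∃ u : (Fin n → ℚ_[p]) → ℝ, IsWeakSolution p n α N f g u := by
  classical
  obtain ⟨C, hC⟩ := hψbdd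
  have hc := cna_pos p n α hα
  have hWpos := W_pos p n hn α hα N
  have hwint := w_integrable p n α hα N
  have hΩ := Bball_meas p n N
  have hMpos : 0 < (padicHaarN p n).real (Bball p n N) :=
    ENNReal.toReal_pos (Bball_pos p n N).ne' (Bball_lt_top p n N).ne
  have hNop := Nop_out p n α N ψ
  have hmemiff := memH_iff p n α N g
  have hwv := wv_integrable p n α hα N
  unfold IsWeakSolution
  have hfin : IsFiniteMeasure ((padicHaarN p n).restrict (Bball p n N)) :=
    ⟨by rw [Measure.restrict_apply_univ]; exact Bball_lt_top p n N⟩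
  set c := cna p n α
  set μ := padicHaarN p n
  set Ω := Bball p n N with hΩdef
  set ν := μ.restrict Ω with hν
  set M := μ.real Ω with hM
  set w : (Fin n → ℚ_[p]) → ℝ := fun y => (‖y‖ ^ ((n : ℝ) + α))⁻¹ with hwdef
  set W := ∫ y in Ωᶜ, w y ∂μ with hW
  have hwmeas : Measurable w := by simp only [hwdef]; fun_prop
  have hw0 : ∀ y, 0 ≤ w y := fun y => by simp only [hwdef]; positivity
  have hνM : ν.real Set.univ = M := by
    rw [hν, hM, Measure.real, Measure.real, Measure.restrict_apply_univ]
  -- psi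
  have hψint : IntegrableOn ψ Ω μ :=
    Integrable.of_bound (μ := ν) hψmeas.aestronglyMeasurable C
      (Filter.Eventually.of_forall hC)
  set m := (∫ x, ψ x ∂ν) / M with hm
  have hg : ∀ y ∈ Ωᶜ, g y = c * M * ((ψ y - m) * w y) := by
    intro y hy
    rw [← hψg y hy, hNop hψint y hy]
    simp only [hm, hwdef]
    field_simp
  have hUb : ∀ y, |ψ y - m| ≤ C + |m| := fun y => (abs_sub _ _).trans (by gcongr; exact hC y)
  -- f
  have hf2 : MemLp f 2 ν := by
    rw [memLp_two_iff_integrable_sq hfmeas.aestronglyMeasurable]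
    rwa [int_iff (by fun_prop) (fun x => by positivity)]
  have hfint : Integrable f ν := hf2.integrable (by norm_num)
  set mf := (∫ x, f x ∂ν) / M with hmf
  set F : (Fin n → ℚ_[p]) → ℝ := fun x => (c * W)⁻¹ * (f x - mf) with hFdef
  have hF : MemLp F 2 ν := (hf2.sub (memLp_const mf)).const_mul _
  set k : (Fin n → ℚ_[p]) × (Fin n → ℚ_[p]) → ℝ :=
    fun z => ‖z.1 - z.2‖ ^ ((n : ℝ) + α) with hk
  have hkmeas : Measurable k := by simp only [hk]; fun_prop
  have hk0 : ∀ z, 0 ≤ k z := fun z => by simp only [hk]; positivity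
  set r : (Fin n → ℚ_[p]) × (Fin n → ℚ_[p]) → ℝ := fun z => Real.sqrt ((2 * W)⁻¹ * (k z)⁻¹) with hr
  have hrmeas : Measurable r := by simp only [hr]; fun_prop
  have hr2 : ∀ z, r z * r z = (2 * W)⁻¹ * (k z)⁻¹ := fun z =>
    Real.mul_self_sqrt (mul_nonneg (by positivity) (inv_nonneg.2 (hk0 z)))
  obtain ⟨u, humeas, hu2, hdu, hsol⟩ := exists_graph_solution ν r F hF
  have hrI : ∀ v : (Fin n → ℚ_[p]) → ℝ, Measurable v →
      (MemLp (fun z => r z * (v z.1 - v z.2)) 2 (ν.prod ν) ↔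
        IntegrableOn (fun z => (v z.1 - v z.2) ^ 2 / k z) (Ω ×ˢ Ω) (μ.prod μ)) := by
    intro v hv
    rw [memLp_two_iff_integrable_sq (by
      apply Measurable.aestronglyMeasurable; fun_prop), IntegrableOn, ← Measure.prod_restrict]
    have : (fun z : (Fin n → ℚ_[p]) × (Fin n → ℚ_[p]) => (r z * (v z.1 - v z.2)) ^ 2) =
        fun z => (2 * W)⁻¹ * ((v z.1 - v z.2) ^ 2 / k z) := by
      ext z
      rw [mul_pow, sq (r z), hr2]; ring
    rw [this, integrable_const_mul_iff (IsUnit.mk0 _ (by positivity))]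
  have huint : Integrable u ν := hu2.integrable (by norm_num)
  -- mean zero
  have hu0 : ∫ x, u x ∂ν = 0 := by
    have h1 := hsol (fun _ => 1) (memLp_const 1) (by simp)
    simp only [sub_self, mul_zero, integral_zero, zero_add, mul_one] at h1
    rw [h1]
    simp only [hFdef]
    rw [integral_const_mul, integral_sub hfint (integrable_const _), integral_const, hνM,
      smul_eq_mul, hmf, show M * ((∫ x, f x ∂ν) / M) = ∫ x, f x ∂ν by field_simp, sub_self,
      mul_zero]
  set ub : (Fin n → ℚ_[p]) → ℝ := fun x => if x ∈ Ω then u x else ψ x - m with hub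
  have hubmeas : Measurable ub := Measurable.ite hΩ humeas (hψmeas.sub_const m)
  have hubin : ∀ x ∈ Ω, ub x = u x := fun x hx => if_pos hx
  have hubout : ∀ x ∈ Ωᶜ, ub x = ψ x - m := fun x hx => if_neg hx
  have hUw : ∀ V : (Fin n → ℚ_[p]) → ℝ, IntegrableOn (fun y => V y * w y) Ωᶜ μ →
      IntegrableOn (fun y => (ψ y - m) * V y * w y) Ωᶜ μ := by
    intro V hV
    have := Integrable.bdd_mul (c := C + |m|) (f := fun y => ψ y - m) hV
      (by apply Measurable.aestronglyMeasurable; fun_prop)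
      (Filter.Eventually.of_forall hUb)
    simpa only [mul_assoc, IntegrableOn] using this
  have hUw1 : IntegrableOn (fun y => (ψ y - m) * w y) Ωᶜ μ := by
    have := hUw (fun _ => 1) (by simpa using hwint)
    simpa using this
  have hUw2 := hUw _ hUw1
  -- cross terms
  have hcr : ∀ v : (Fin n → ℚ_[p]) → ℝ, MemLp v 2 ν →
      IntegrableOn (fun y => v y * w y) Ωᶜ μ →
      IntegrableOn (fun z => (ub z.1 - ub z.2) * (v z.1 - v z.2) / k z) (Ω ×ˢ Ωᶜ) (μ.prod μ) ∧
      ∫ z in Ω ×ˢ Ωᶜ, (ub z.1 - ub z.2) * (v z.1 - v z.2) / k z ∂(μ.prod μ) =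
      (∫ x, u x * v x ∂ν) * W - (∫ x, v x ∂ν) * (∫ y in Ωᶜ, (ψ y - m) * w y ∂μ)
        + M * ∫ y in Ωᶜ, (ψ y - m) * v y * w y ∂μ := by
    intro v hv2 hvw
    have huv : Integrable (fun x => u x * v x) ν := hu2.integrable_mul hv2
    obtain ⟨i1, i2⟩ := cross_term ν (μ.restrict Ωᶜ) u v (fun y => ψ y - m) v w huv huint
      (hv2.integrable (by norm_num)) hwint hvw hUw1 (hUw v hvw)
    rw [hν, Measure.prod_restrict] at i1 i2
    have hcongr : Set.EqOn (fun z : (Fin n → ℚ_[p]) × (Fin n → ℚ_[p]) =>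
        (u z.1 - (ψ z.2 - m)) * (v z.1 - v z.2) * w z.2)
        (fun z => (ub z.1 - ub z.2) * (v z.1 - v z.2) / k z) (Ω ×ˢ Ωᶜ) := by
      rintro ⟨x, y⟩ ⟨hx, hy⟩
      simp only [hk, hwdef]
      rw [hubin x hx, hubout y hy, norm_sub_out hx hy, div_eq_mul_inv]
    refine ⟨IntegrableOn.congr_fun i1 hcongr (hΩ.prod hΩ.compl), ?_⟩
    rw [← setIntegral_congr_fun (hΩ.prod hΩ.compl) hcongr, i2, ← hν, hu0, hνM, zero_mul, sub_zero]
  have hub2 : MemLp ub 2 ν := hu2.ae_eq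
    ((ae_restrict_of_forall_mem hΩ fun x hx => (hubin x hx).symm))
  refine ⟨ub, ?_, ?_⟩
  · rw [hmemiff ub hgmeas hubmeas]
    refine ⟨?_, ?_, ?_, ?_⟩
    · exact (memLp_two_iff_integrable_sq hubmeas.aestronglyMeasurable).1 hub2
    · have := Integrable.bdd_mul (c := (C + |m|) ^ 2) (f := fun y => (ψ y - m) ^ 2)
        (Integrable.abs hgL1)
        (by apply Measurable.aestronglyMeasurable; fun_prop)
        (Filter.Eventually.of_forall fun y => by
          rw [Real.norm_of_nonneg (by positivity), ← sq_abs]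
          gcongr; exact hUb y)
      refine IntegrableOn.congr_fun this ?_ hΩ.compl
      intro y hy
      simp only
      rw [hubout y hy, mul_comm]
    · refine IntegrableOn.congr_fun ((hrI u humeas).1 hdu) ?_ (hΩ.prod hΩ)
      rintro ⟨x, y⟩ ⟨hx, hy⟩
      simp only
      rw [hubin x hx, hubin y hy]
    · have := (hcr ub hub2 (hUw1.congr_fun (fun y hy => by
        simp only; rw [hubout y hy]) hΩ.compl)).1
      simpa only [sq] using this
  · intro v hv
    have hvmeas := hv.1
    obtain ⟨v1, -, v3, v4⟩ := (hmemiff v hgmeas hvmeas).1 hv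
    have hv2 : MemLp v 2 ν := (memLp_two_iff_integrable_sq hvmeas.aestronglyMeasurable).2 v1
    have hdv := (hrI v hvmeas).2 v3
    have hvint : Integrable v ν := hv2.integrable (by norm_num)
    have hvw : IntegrableOn (fun y => v y * w y) Ωᶜ μ := by
      refine Integrable.mono' (Integrable.add hwint (hwv v hvmeas v1 v4)) ?_ ?_
      · apply Measurable.aestronglyMeasurable; fun_prop
      · refine Filter.Eventually.of_forall fun y => ?_
        simp only [Pi.add_apply]
        change _ ≤ w y + v y ^ 2 * w y
        rw [Real.norm_eq_abs, abs_mul, abs_of_nonneg (hw0 y), ← sq_abs]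
        nlinarith [mul_nonneg (hw0 y) (sq_nonneg (|v y| - 1)), mul_nonneg (hw0 y) (sq_nonneg (|v y|)),
          hw0 y]
    obtain ⟨j1, j2⟩ := hcr v hv2 hvw
    have hsolv := hsol v hv2 hdv
    have hAeq : Set.EqOn (fun z : (Fin n → ℚ_[p]) × (Fin n → ℚ_[p]) =>
        2 * W * ((r z * (u z.1 - u z.2)) * (r z * (v z.1 - v z.2))))
        (fun z => (ub z.1 - ub z.2) * (v z.1 - v z.2) / k z) (Ω ×ˢ Ω) := by
      rintro ⟨x, y⟩ ⟨hx, hy⟩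
      simp only
      rw [hubin x hx, hubin y hy]
      calc _ = 2 * W * (r (x, y) * r (x, y)) * ((u x - u y) * (v x - v y)) := by ring
        _ = _ := by
          rw [hr2, div_eq_mul_inv]
          have : 2 * W * ((2 * W)⁻¹ * (k (x, y))⁻¹) = (k (x, y))⁻¹ := by
            rw [← mul_assoc, mul_inv_cancel₀ (by positivity), one_mul]
          rw [this]; ring
    have hAint : IntegrableOn (fun z : (Fin n → ℚ_[p]) × (Fin n → ℚ_[p]) =>
        2 * W * ((r z * (u z.1 - u z.2)) * (r z * (v z.1 - v z.2)))) (Ω ×ˢ Ω) (μ.prod μ) := by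
      rw [IntegrableOn, ← Measure.prod_restrict]
      exact (hdu.integrable_mul hdv).const_mul _
    have hA : ∫ z in Ω ×ˢ Ω, (ub z.1 - ub z.2) * (v z.1 - v z.2) / k z ∂(μ.prod μ) =
        2 * W * ∫ z, (r z * (u z.1 - u z.2)) * (r z * (v z.1 - v z.2)) ∂(ν.prod ν) := by
      rw [← setIntegral_congr_fun (hΩ.prod hΩ) hAeq, integral_const_mul, hν, Measure.prod_restrict]
    have hS := integral_S μ hΩ (fun z => (ub z.1 - ub z.2) * (v z.1 - v z.2) / k z) (by
      intro z
      simp only [hk, Prod.fst_swap, Prod.snd_swap]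
      rw [norm_sub_rev]; ring) (hAint.congr_fun hAeq (hΩ.prod hΩ)) j1
    rw [hS, hA, j2]
    have hgv : ∫ y in Ωᶜ, g y * v y ∂μ = c * M * ∫ y in Ωᶜ, (ψ y - m) * v y * w y ∂μ := by
      rw [← integral_const_mul]
      apply setIntegral_congr_fun hΩ.compl
      intro y hy
      simp only
      rw [hg y hy]; ring
    have hgi : ∫ y in Ωᶜ, g y ∂μ = c * M * ∫ y in Ωᶜ, (ψ y - m) * w y ∂μ := by
      rw [← integral_const_mul]
      exact setIntegral_congr_fun hΩ.compl hg
    have hFv : ∫ x, F x * v x ∂ν = (c * W)⁻¹ * ((∫ x, f x * v x ∂ν) - mf * ∫ x, v x ∂ν) := by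
      have hfv : Integrable (fun x => f x * v x) ν := hf2.integrable_mul hv2
      rw [← integral_const_mul mf, ← integral_sub hfv (hvint.const_mul _),
        ← integral_const_mul (c * W)⁻¹]
      congr 1; ext x; simp only [hFdef]; ring
    have hmf' : mf = - (c * ∫ y in Ωᶜ, (ψ y - m) * w y ∂μ) := by
      rw [hmf, hcomp, hgi]; field_simp
    rw [hFv] at hsolv
    rw [hgv]
    set A := ∫ z, (r z * (u z.1 - u z.2)) * (r z * (v z.1 - v z.2)) ∂(ν.prod ν)
    set B := ∫ x, u x * v x ∂ν
    set P := ∫ y in Ωᶜ, (ψ y - m) * w y ∂μ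
    set Q := ∫ y in Ωᶜ, (ψ y - m) * v y * w y ∂μ
    set R := ∫ x, f x * v x ∂ν
    set T := ∫ x, v x ∂ν
    have h5 : c * W * (A + B) = R - mf * T := by
      rw [hsolv, ← mul_assoc, mul_inv_cancel₀ (by positivity), one_mul]
    rw [hmf'] at h5
    linear_combination h5

theorem padic_neumann_existence (p : ℕ) [Fact p.Prime] (n : ℕ) (hn : 1 ≤ n)
    (α : ℝ) (hα : 0 < α) (N : ℤ)
    (f g : (Fin n → ℚ_[p]) → ℝ)
    (hfmeas : Measurable f)
    (hfL2 : (∫⁻ x in Bball p n N, ENNReal.ofReal ((f x) ^ 2) ∂padicHaarN p n) < ⊤)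
    (hgmeas : Measurable g)
    (hgL1 : IntegrableOn g (Bball p n N)ᶜ (padicHaarN p n))
    (ψ : (Fin n → ℚ_[p]) → ℝ) (hψmeas : Measurable ψ)
    (hψbdd : ∃ C : ℝ, ∀ x, |ψ x| ≤ C)
    (hψloc : ∃ ℓ : ℤ, ∀ x x' : Fin n → ℚ_[p], ‖x'‖ ≤ (p : ℝ) ^ (-ℓ) → ψ (x + x') = ψ x)
    (hψg : ∀ y ∈ (Bball p n N)ᶜ, Nop p n α N ψ y = g y) :
    (∃ u : (Fin n → ℚ_[p]) → ℝ, IsWeakSolution p n α N f g u) ↔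
      (∫ x in Bball p n N, f x ∂padicHaarN p n)
        = - ∫ y in (Bball p n N)ᶜ, g y ∂padicHaarN p n := by
  constructor
  · rintro ⟨u, -, hu⟩
    have h1 : MemH p n α N g (fun _ => 1) := by
      rw [memH_iff p n α N g _ hgmeas measurable_const]
      refine ⟨?_, ?_, ?_, ?_⟩
      · exact integrableOn_const (Bball_lt_top p n N).ne
      · simpa [IntegrableOn] using hgL1.abs
      · simp
      · simp
    have h2 := hu _ h1
    simp only [sub_self, mul_zero, zero_div, integral_zero, mul_one] at h2
    linarith
  · exact suff_direction p n hn α hα N f g hfmeas hfL2 hgmeas hgL1 ψ hψmeas hψbdd hψg
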